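/- (Pfaff-type recurrence for Rogers' ₆φ₅ sum) Let q be a nonzero complex number, let n ≥ 1 be an integer, and let s, b, c be nonzero complex numbers (write a = s²) such that (q;q)_n ≠ 0, (s;q)_{n+1} ≠ 0, (−s;q)_{n+1} ≠ 0, (s²q/b;q)_{n+1} ≠ 0, (s²q/c;q)_{n+1} ≠ 0, and (s²q^{n−1};q)_{n+2} ≠ 0. Define S_n(s,b,c;q) := ∑_{j=0}^{n} ((s²;q)_j (qs;q)_j (−qs;q)_j (b;q)_j (c;q)_j (q^{-n};q)_j / ((q;q)_j (s;q)_j (−s;q)_j (s²q/b;q)_j (s²q/c;q)_j (s²q^{n+1};q)_j)) (s²q^{n+1}/(bc))^j. Then S_n(s,b,c;q) − S_{n−1}(s,b,c;q) = − ((1−s²q)(1−s²q²)(1−b)(1−c)(s²q^n/(bc)) / ((1−s²q^n)(1−s²q^{n+1})(1−s²q/b)(1−s²q/c))) · S_{n−1}(sq, bq, cq; q), where S_{n−1}(sq,bq,cq;q) is the same sum with s replaced by sq, b by bq, c by cq, and n by n−1 (i.e. a = s² is replaced by aq²). -/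

import Mathlib

/-- The $q$-shifted factorial $(a;q)_m = \prod_{k=0}^{m-1}(1 - a q^k)$. -/
noncomputable def qPoch (q a : ℂ) (m : ℕ) : ℂ := ∏ k ∈ Finset.range m, (1 - a * q ^ k)

/-- Rogers' terminating ${}_6\phi_5$ sum (with $a = s^2$). -/
noncomputable def S65 (q s b c : ℂ) (n : ℕ) : ℂ :=
  ∑ j ∈ Finset.range (n + 1),
    qPoch q (s ^ 2) j * qPoch q (q * s) j * qPoch q (-(q * s)) j * qPoch q b j *
      qPoch q c j * qPoch q (q ^ (-(n : ℤ))) j /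
      (qPoch q q j * qPoch q s j * qPoch q (-s) j * qPoch q (s ^ 2 * q / b) j *
        qPoch q (s ^ 2 * q / c) j * qPoch q (s ^ 2 * q ^ (n + 1)) j) *
      (s ^ 2 * q ^ (n + 1) / (b * c)) ^ j

theorem qPoch_succ (q a : ℂ) (m : ℕ) : qPoch q a (m + 1) = qPoch q a m * (1 - a * q ^ m) :=
  Finset.prod_range_succ _ _

theorem qPoch_succ' (q a : ℂ) (m : ℕ) :
    qPoch q a (m + 1) = (1 - a) * qPoch q (a * q) m := by
  unfold qPoch
  rw [Finset.prod_range_succ', mul_comm]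
  simp [pow_succ', mul_assoc]

theorem qPoch_factor_ne_zero {q a : ℂ} {m k : ℕ} (h : qPoch q a m ≠ 0) (hk : k < m) :
    1 - a * q ^ k ≠ 0 :=
  Finset.prod_ne_zero_iff.mp h k (Finset.mem_range.mpr hk)

theorem qPoch_ne_zero_of_le {q a : ℂ} {m k : ℕ} (h : qPoch q a m ≠ 0) (hk : k ≤ m) :
    qPoch q a k ≠ 0 :=
  Finset.prod_ne_zero_iff.mpr fun _ hi =>
    qPoch_factor_ne_zero h ((Finset.mem_range.mp hi).trans_le hk)

theorem qPoch_inv_pow_eq_zero {q : ℂ} (hq : q ≠ 0) (m : ℕ) :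
    qPoch q (q ^ (-(m : ℤ))) (m + 1) = 0 := by
  rw [qPoch_succ, zpow_neg, zpow_natCast, inv_mul_cancel₀ (pow_ne_zero _ hq), sub_self, mul_zero]

/-- The very-well-poised factor of the summand. -/
theorem qPoch_very_well_poised {q s : ℂ} {m : ℕ} (h2 : qPoch q s (m + 1) ≠ 0)
    (h3 : qPoch q (-s) (m + 1) ≠ 0) :
    qPoch q (q * s) m * qPoch q (-(q * s)) m =
      (1 - s ^ 2 * q ^ (2 * m)) / (1 - s ^ 2) * (qPoch q s m * qPoch q (-s) m) := by
  have e2 := (qPoch_succ' q s m).symm.trans (qPoch_succ q s m)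
  have e3 := (qPoch_succ' q (-s) m).symm.trans (qPoch_succ q (-s) m)
  have n2 : 1 - s ≠ 0 := by simpa using qPoch_factor_ne_zero h2 m.succ_pos
  have n3 : 1 + s ≠ 0 := by simpa using qPoch_factor_ne_zero h3 m.succ_pos
  have n : 1 - s ^ 2 ≠ 0 := by
    rw [show 1 - s ^ 2 = (1 - s) * (1 + s) by ring]
    exact mul_ne_zero n2 n3
  rw [mul_comm q s, ← neg_mul, div_mul_eq_mul_div, eq_div_iff n]
  calc qPoch q (s * q) m * qPoch q (-s * q) m * (1 - s ^ 2)
      = ((1 - s) * qPoch q (s * q) m) * ((1 - -s) * qPoch q (-s * q) m) := by ring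
    _ = _ := by rw [e2, e3]; ring

/-- The summand of `S65`. -/
noncomputable def S65Term (q s b c : ℂ) (n j : ℕ) : ℂ :=
  qPoch q (s ^ 2) j * qPoch q (q * s) j * qPoch q (-(q * s)) j * qPoch q b j *
      qPoch q c j * qPoch q (q ^ (-(n : ℤ))) j /
      (qPoch q q j * qPoch q s j * qPoch q (-s) j * qPoch q (s ^ 2 * q / b) j *
        qPoch q (s ^ 2 * q / c) j * qPoch q (s ^ 2 * q ^ (n + 1)) j) *
      (s ^ 2 * q ^ (n + 1) / (b * c)) ^ j

theorem S65_eq_sum (q s b c : ℂ) (n : ℕ) :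
    S65 q s b c n = ∑ j ∈ Finset.range (n + 1), S65Term q s b c n j := rfl

theorem S65Term_zero (q s b c : ℂ) (n : ℕ) : S65Term q s b c n 0 = 1 := by
  simp [S65Term, qPoch]

theorem S65Term_succ_self {q : ℂ} (hq : q ≠ 0) (s b c : ℂ) (n : ℕ) :
    S65Term q s b c n (n + 1) = 0 := by
  simp [S65Term, -zpow_neg, qPoch_inv_pow_eq_zero hq]

theorem S65Term_eq {q s : ℂ} (b c : ℂ) (n : ℕ) {j : ℕ} (h2 : qPoch q s (j + 1) ≠ 0)
    (h3 : qPoch q (-s) (j + 1) ≠ 0) :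
    S65Term q s b c n j =
      (1 - s ^ 2 * q ^ (2 * j)) / (1 - s ^ 2) *
      (qPoch q (s ^ 2) j * qPoch q b j * qPoch q c j * qPoch q (q ^ (-(n : ℤ))) j /
      (qPoch q q j * qPoch q (s ^ 2 * q / b) j *
        qPoch q (s ^ 2 * q / c) j * qPoch q (s ^ 2 * q ^ (n + 1)) j)) *
      (s ^ 2 * q ^ (n + 1) / (b * c)) ^ j := by
  have e := qPoch_very_well_poised h2 h3
  have n2 := qPoch_ne_zero_of_le h2 j.le_succ
  have n3 := qPoch_ne_zero_of_le h3 j.le_succ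
  unfold S65Term
  congr 1
  rw [show qPoch q (s ^ 2) j * qPoch q (q * s) j * qPoch q (-(q * s)) j * qPoch q b j *
      qPoch q c j * qPoch q (q ^ (-(n : ℤ))) j = (qPoch q (q * s) j * qPoch q (-(q * s)) j) *
      (qPoch q (s ^ 2) j * qPoch q b j * qPoch q c j * qPoch q (q ^ (-(n : ℤ))) j) by ring, e,
    show qPoch q q j * qPoch q s j * qPoch q (-s) j * qPoch q (s ^ 2 * q / b) j *
        qPoch q (s ^ 2 * q / c) j * qPoch q (s ^ 2 * q ^ (n + 1)) j =
      (qPoch q s j * qPoch q (-s) j) * (qPoch q q j * qPoch q (s ^ 2 * q / b) j *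
        qPoch q (s ^ 2 * q / c) j * qPoch q (s ^ 2 * q ^ (n + 1)) j) by ring,
    mul_assoc (_ / _) (_ * _) (_ * _), mul_div_assoc, mul_div_mul_left _ _ (mul_ne_zero n2 n3)]

theorem S65Term_bracket {q M E : ℂ} (a y : ℂ) (hq : q ≠ 0) (hM : M ≠ 0)
    (h1 : 1 - a * (M * q) ≠ 0) (h2 : 1 - a * (M * q * q) ≠ 0)
    (h3 : 1 - a * (M * q * q) * y ≠ 0) (hE : E ≠ 0) :
    (1 - (M * q)⁻¹) * (y * q) / ((1 - a * (M * q * q)) * E) -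
        (1 - M⁻¹ * y) / ((1 - a * (M * q)) *
          ((1 - a * (M * q * q)) * E / (1 - a * (M * q * q) * y))) =
      -((1 - q * y) * (1 - a * q * y) / ((1 - a * (M * q)) * (1 - a * (M * q * q)) * E)) := by
  generalize e1 : 1 - a * (M * q) = d1 at *
  generalize e2 : 1 - a * (M * q * q) = d2 at *
  generalize e3 : 1 - a * (M * q * q) * y = d3 at *
  field_simp
  subst e1 e3
  ring

/-- The recurrence holds term by term, after shifting the index of summation. -/
theorem S65Term_recurrence {q : ℂ} (hq : q ≠ 0) {m j : ℕ} (hj : j ≤ m) {s b c : ℂ}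
    (hb : b ≠ 0) (hc : c ≠ 0)
    (h1 : qPoch q q (m + 1) ≠ 0) (h2 : qPoch q s (m + 2) ≠ 0) (h3 : qPoch q (-s) (m + 2) ≠ 0)
    (h4 : qPoch q (s ^ 2 * q / b) (m + 2) ≠ 0) (h5 : qPoch q (s ^ 2 * q / c) (m + 2) ≠ 0)
    (h6 : qPoch q (s ^ 2 * q ^ m) (m + 3) ≠ 0) :
    S65Term q s b c (m + 1) (j + 1) - S65Term q s b c m (j + 1)
      = -((1 - s ^ 2 * q) * (1 - s ^ 2 * q ^ 2) * (1 - b) * (1 - c) *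
            (s ^ 2 * q ^ (m + 1) / (b * c)) /
          ((1 - s ^ 2 * q ^ (m + 1)) * (1 - s ^ 2 * q ^ (m + 2)) * (1 - s ^ 2 * q / b) *
            (1 - s ^ 2 * q / c)))
          * S65Term q (s * q) (b * q) (c * q) m j := by
  have h2' := qPoch_ne_zero_of_le h2 (show j + 2 ≤ m + 2 by omega)
  have h3' := qPoch_ne_zero_of_le h3 (show j + 2 ≤ m + 2 by omega)
  have h2s : qPoch q (s * q) (j + 1) ≠ 0 := by
    rw [qPoch_succ'] at h2'; exact right_ne_zero_of_mul h2'
  have h3s : qPoch q (-(s * q)) (j + 1) ≠ 0 := by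
    rw [qPoch_succ', neg_mul] at h3'; exact right_ne_zero_of_mul h3'
  rw [S65Term_eq _ _ _ h2' h3', S65Term_eq _ _ _ h2' h3', S65Term_eq _ _ _ h2s h3s]
  have n0 : 1 - s ^ 2 ≠ 0 := by
    have u := qPoch_factor_ne_zero h2 (show 0 < m + 2 by omega)
    have v := qPoch_factor_ne_zero h3 (show 0 < m + 2 by omega)
    convert mul_ne_zero u v using 1; ring
  have n1 : 1 - s ^ 2 * q ^ 2 ≠ 0 := by
    have u := qPoch_factor_ne_zero h2 (show 1 < m + 2 by omega)
    have v := qPoch_factor_ne_zero h3 (show 1 < m + 2 by omega)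
    convert mul_ne_zero u v using 1; ring
  have h1' := qPoch_ne_zero_of_le h1 (show j + 1 ≤ m + 1 by omega)
  have h4' := qPoch_ne_zero_of_le h4 (show j + 1 ≤ m + 2 by omega)
  have h5' := qPoch_ne_zero_of_le h5 (show j + 1 ≤ m + 2 by omega)
  have h6' := qPoch_ne_zero_of_le h6 (show j + 3 ≤ m + 3 by omega)
  rw [qPoch_succ] at h1'
  rw [qPoch_succ'] at h4' h5'
  have eF : (1 - s ^ 2 * q ^ (m + 2)) * qPoch q (s ^ 2 * q ^ (m + 3)) j =
      qPoch q (s ^ 2 * q ^ (m + 2)) j * (1 - s ^ 2 * q ^ (m + 2) * q ^ j) := by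
    rw [← qPoch_succ, qPoch_succ', mul_assoc (s ^ 2), ← pow_succ]
  have eX : (1 - s ^ 2 * q) * qPoch q (s ^ 2 * q ^ 2) j =
      qPoch q (s ^ 2 * q) j * (1 - s ^ 2 * q * q ^ j) := by
    rw [← qPoch_succ, qPoch_succ', mul_assoc (s ^ 2), ← pow_two]
  have e6 : qPoch q (s ^ 2 * q ^ m) (j + 3) = (1 - s ^ 2 * q ^ m) * ((1 - s ^ 2 * q ^ (m + 1)) *
      ((1 - s ^ 2 * q ^ (m + 2)) * qPoch q (s ^ 2 * q ^ (m + 3)) j)) := by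
    simp only [qPoch_succ' q _ (j + 2), qPoch_succ' q _ (j + 1), qPoch_succ' q _ j, mul_assoc,
      ← pow_succ]
  rw [e6] at h6'
  have i1 : s ^ 2 * q ^ (m + 1 + 1) = s ^ 2 * q ^ (m + 2) := rfl
  have i2 : (s * q) ^ 2 * q ^ (m + 1) = s ^ 2 * q ^ (m + 3) := by ring
  have i3 : (s * q) ^ 2 * q / (b * q) = s ^ 2 * q / b * q := by field_simp
  have i4 : (s * q) ^ 2 * q / (c * q) = s ^ 2 * q / c * q := by field_simp
  have i5 : s ^ 2 * q ^ (m + 3) / (b * q * (c * q)) = s ^ 2 * q ^ (m + 1) / (b * c) := by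
    field_simp; ring
  have i6 : s ^ 2 * q ^ (m + 2) / (b * c) = s ^ 2 * q ^ (m + 1) / (b * c) * q := by ring
  have i7 : q ^ (-((m + 1 : ℕ) : ℤ)) * q = q ^ (-(m : ℤ)) := by
    rw [← zpow_add_one₀ hq]; congr 1; push_cast; ring
  have i8 : q ^ (-((m + 1 : ℕ) : ℤ)) = (q ^ (m + 1))⁻¹ := by
    rw [zpow_neg, zpow_natCast]
  have i9 : q ^ (-(m : ℤ)) = (q ^ m)⁻¹ := by rw [zpow_neg, zpow_natCast]
  rw [i1, i2, i3, i4, i5, i6, mul_pow s q 2, qPoch_succ' q (s ^ 2), qPoch_succ' q b,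
    qPoch_succ' q c, qPoch_succ q q, qPoch_succ' q (s ^ 2 * q / b), qPoch_succ' q (s ^ 2 * q / c),
    qPoch_succ' q (q ^ (-((m + 1 : ℕ) : ℤ))), i7, qPoch_succ q (q ^ (-(m : ℤ))),
    qPoch_succ' q (s ^ 2 * q ^ (m + 2)), qPoch_succ' q (s ^ 2 * q ^ (m + 1)), i8,
    mul_assoc (s ^ 2) (q ^ (m + 2)) q, ← pow_succ, mul_assoc (s ^ 2) (q ^ (m + 1)) q, ← pow_succ]
  simp only [show m + 2 + 1 = m + 3 from rfl]
  have n7 : 1 - s ^ 2 * q ^ (m + 2) * q ^ j ≠ 0 := by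
    have u := qPoch_factor_ne_zero h6 (show j + 2 < m + 3 by omega)
    convert u using 1; ring
  replace eF := (div_eq_iff n7).mpr eF
  have ne : ∀ {x y : ℂ}, x * y ≠ 0 → x ≠ 0 ∧ y ≠ 0 := fun h =>
    ⟨left_ne_zero_of_mul h, right_ne_zero_of_mul h⟩
  obtain ⟨nq, nq'⟩ := ne h1'
  obtain ⟨nb, nb'⟩ := ne h4'
  obtain ⟨nc, nc'⟩ := ne h5'
  obtain ⟨-, k6⟩ := ne h6'
  obtain ⟨nm, k6⟩ := ne k6
  obtain ⟨nm', nE⟩ := ne k6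
  have nM : q ^ m ≠ 0 := pow_ne_zero _ hq
  rw [← eF, i9]
  rw [pow_succ q m] at nm
  rw [show m + 2 = m + 1 + 1 from rfl, pow_succ q (m + 1), pow_succ q m] at nm' n7
  rw [show 2 * (j + 1) = j + j + 2 by ring, show 2 * j = j + j by ring,
    show m + 2 = m + 1 + 1 from rfl, mul_pow (_ / _) q (j + 1), pow_succ (_ / _) j]
  simp only [pow_succ q (m + 1), pow_succ q m, pow_succ q j, pow_add q j j, pow_add q (j + j) 2]
  clear e6 i1 i2 i3 i4 i5 i6 i7 i8 h1 h2 h3 h4 h5 h6 h1' h2' h3' h4' h5' h6' h2s h3s k6 eF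
  generalize qPoch q (s ^ 2 * q ^ (m + 3)) j = E at *
  generalize qPoch q (s ^ 2 * q ^ 2) j = P at *
  generalize qPoch q (s ^ 2 * q) j = X at *
  generalize qPoch q (s ^ 2 * q / b * q) j = Nb at *
  generalize qPoch q (s ^ 2 * q / c * q) j = Nc at *
  generalize qPoch q (b * q) j = B at *
  generalize qPoch q (c * q) j = C at *
  generalize qPoch q q j = Q at *
  generalize qPoch q (q ^ m)⁻¹ j = R at *
  generalize 1 - s ^ 2 * q / b = Db at *
  generalize 1 - s ^ 2 * q / c = Dc at *
  generalize s ^ 2 * (q ^ m * q) / (b * c) = Z at *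
  generalize Z ^ j = W at *
  generalize q ^ m = M at *
  generalize q ^ j = y at *
  generalize s ^ 2 = a at *
  generalize 1 - b = b' at *
  generalize 1 - c = c' at *
  calc _ = (1 - a) / (1 - a) * (X * (1 - a * (y * y * q ^ 2)) * b' * c' * Z * W * B * C * R /
        (Q * (1 - q * y) * Db * Nb * Dc * Nc)) *
        ((1 - (M * q)⁻¹) * (y * q) / ((1 - a * (M * q * q)) * E) -
          (1 - M⁻¹ * y) / ((1 - a * (M * q)) *
            ((1 - a * (M * q * q)) * E / (1 - a * (M * q * q) * y)))) := by
        simp only [div_eq_mul_inv, mul_inv, inv_inv]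
        ring
    _ = -((X * (1 - a * q * y)) * (1 - a * (y * y * q ^ 2)) * b' * c' * Z * W * B * C * R /
        (Q * Db * Nb * Dc * Nc * ((1 - a * (M * q)) * (1 - a * (M * q * q)) * E))) *
          ((1 - q * y) / (1 - q * y)) := by
        rw [S65Term_bracket a y hq nM nm nm' n7 nE, div_self n0]
        simp only [div_eq_mul_inv, mul_inv]
        ring
    _ = (1 - a * q ^ 2) / (1 - a * q ^ 2) *
        -((1 - a * q) * P * (1 - a * (y * y * q ^ 2)) * b' * c' * Z * W * B * C * R /
        (Q * Db * Nb * Dc * Nc * ((1 - a * (M * q)) * (1 - a * (M * q * q)) * E))) := by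
        rw [← eX, div_self nq', div_self n1]
        simp only [div_eq_mul_inv, mul_inv]
        ring
    _ = _ := by
        simp only [div_eq_mul_inv, mul_inv]
        ring

/-- Pfaff-type recurrence for Rogers' ${}_6\phi_5$ sum. -/
theorem rogers_recurrence (q : ℂ) (hq : q ≠ 0) (n : ℕ) (hn : 1 ≤ n) (s b c : ℂ)
    (hs : s ≠ 0) (hb : b ≠ 0) (hc : c ≠ 0)
    (h1 : qPoch q q n ≠ 0) (h2 : qPoch q s (n + 1) ≠ 0) (h3 : qPoch q (-s) (n + 1) ≠ 0)
    (h4 : qPoch q (s ^ 2 * q / b) (n + 1) ≠ 0) (h5 : qPoch q (s ^ 2 * q / c) (n + 1) ≠ 0)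
    (h6 : qPoch q (s ^ 2 * q ^ ((n : ℤ) - 1)) (n + 2) ≠ 0) :
    S65 q s b c n - S65 q s b c (n - 1)
      = -((1 - s ^ 2 * q) * (1 - s ^ 2 * q ^ 2) * (1 - b) * (1 - c) *
            (s ^ 2 * q ^ n / (b * c)) /
          ((1 - s ^ 2 * q ^ n) * (1 - s ^ 2 * q ^ (n + 1)) * (1 - s ^ 2 * q / b) *
            (1 - s ^ 2 * q / c)))
          * S65 q (s * q) (b * q) (c * q) (n - 1) := by
  obtain ⟨m, rfl⟩ : ∃ m, n = m + 1 := ⟨n - 1, by omega⟩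
  have h6' : qPoch q (s ^ 2 * q ^ m) (m + 3) ≠ 0 := by
    simpa using h6
  rw [Nat.add_sub_cancel, S65_eq_sum, S65_eq_sum, S65_eq_sum, Finset.mul_sum,
    ← add_zero (∑ j ∈ Finset.range (m + 1), S65Term q s b c m j), ← S65Term_succ_self hq s b c m,
    ← Finset.sum_range_succ, ← Finset.sum_sub_distrib, Finset.sum_range_succ', S65Term_zero,
    S65Term_zero, sub_self, add_zero]
  exact Finset.sum_congr rfl fun j hj =>
    S65Term_recurrence hq (Nat.lt_succ_iff.mp (Finset.mem_range.mp hj)) hb hc h1 h2 h3 h4 h5 h6'
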